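/- arXiv:0809.3315 — 2 statements merged into one kernel-verified Lean document; each statement's English description precedes it below -/
import Mathlib

section
/- Let a > 0 and let h be a measurable function on (0,∞) with L_a(h) < ∞. For m ≥ 2 let E_m = {t > 0 : 2^{m−1} < |h(t)| ≤ 2^m} and let E₁ = {t > 0 : 0 < |h(t)| ≤ 2}. Then for every m ≥ 1, ‖h·χ_{E_m}‖_{Δ_{1+1/m}} ≤ C m^{−am/(m+1)} L_a(h)^{m/(m+1)}, where C depends only on a (it is independent of h and m). -/
open MeasureTheory Real Set Filter Topology
open scoped ENNReal

/-- The norm `‖g‖_{Δ_s} = sup_{j ∈ ℤ} (∫_{2^j}^{2^{j+1}} |g(t)|^s dt/t)^{1/s}`. -/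
noncomputable def deltaNorm (s : ℝ) (h : ℝ → ℝ) : ℝ≥0∞ :=
  ⨆ j : ℤ, (∫⁻ t in Set.Ioc ((2:ℝ) ^ j) ((2:ℝ) ^ (j + 1)),
      ENNReal.ofReal (|h t| ^ s / t)) ^ (1 / s)

/-- The quantity `L_a(h) = sup_{j ∈ ℤ} ∫_{2^j}^{2^{j+1}} |h(t)| (log(2+|h(t)|))^a dt/t`. -/
noncomputable def LaNorm (a : ℝ) (h : ℝ → ℝ) : ℝ≥0∞ :=
  ⨆ j : ℤ, ∫⁻ t in Set.Ioc ((2:ℝ) ^ j) ((2:ℝ) ^ (j + 1)),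
    ENNReal.ofReal (|h t| * (Real.log (2 + |h t|)) ^ a / t)

/-- The set `E_m`:  `E₁ = {t > 0 : 0 < |h(t)| ≤ 2}` and, for `m ≥ 2`,
`E_m = {t > 0 : 2^{m-1} < |h(t)| ≤ 2^m}`. -/
def Eset (h : ℝ → ℝ) (m : ℕ) : Set ℝ :=
  if m = 1 then {t | 0 < t ∧ 0 < |h t| ∧ |h t| ≤ 2}
  else {t | 0 < t ∧ (2:ℝ) ^ (m - 1) < |h t| ∧ |h t| ≤ (2:ℝ) ^ m}

/-- On `E_m` the logarithm of `2 + |h|` is at least a constant multiple of `m`. -/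
lemma mul_log_two_le_log_of_mem_Eset {h : ℝ → ℝ} {m : ℕ} (hm : 1 ≤ m) {t : ℝ}
    (ht : t ∈ Eset h m) : (Real.log 2 / 2) * m ≤ Real.log (2 + |h t|) := by
  have hl2 : 0 < Real.log 2 := Real.log_pos one_lt_two
  by_cases h1 : m = 1
  · subst h1
    have : Real.log 2 ≤ Real.log (2 + |h t|) :=
      Real.log_le_log two_pos (by linarith [abs_nonneg (h t)])
    push_cast
    linarith
  · rw [Eset, if_neg h1] at ht
    have h2 : (2 : ℝ) ≤ m := by exact_mod_cast (show 2 ≤ m by omega)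
    have h3 : Real.log ((2 : ℝ) ^ (m - 1)) ≤ Real.log (2 + |h t|) :=
      Real.log_le_log (by positivity) (by linarith [ht.2.1])
    rw [Real.log_pow, Nat.cast_sub hm, Nat.cast_one] at h3
    nlinarith

lemma abs_le_two_pow_of_mem_Eset {h : ℝ → ℝ} {m : ℕ} {t : ℝ} (ht : t ∈ Eset h m) :
    |h t| ≤ (2 : ℝ) ^ m := by
  by_cases h1 : m = 1
  · rw [Eset, if_pos h1] at ht
    simpa [h1] using ht.2.2
  · rw [Eset, if_neg h1] at ht
    exact ht.2.2

lemma abs_rpow_le_two_mul_of_mem_Eset {h : ℝ → ℝ} {m : ℕ} (hm : 1 ≤ m) {t : ℝ}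
    (ht : t ∈ Eset h m) : |h t| ^ (1 + 1 / (m : ℝ)) ≤ 2 * |h t| := by
  have hm0 : m ≠ 0 := by omega
  have hroot : |h t| ^ (1 / (m : ℝ)) ≤ 2 := by
    calc |h t| ^ (1 / (m : ℝ)) ≤ ((2 : ℝ) ^ m) ^ (1 / (m : ℝ)) :=
          Real.rpow_le_rpow (abs_nonneg _) (abs_le_two_pow_of_mem_Eset ht) (by positivity)
      _ = 2 := by rw [one_div, Real.pow_rpow_inv_natCast two_pos.le hm0]
  rw [Real.rpow_add_of_nonneg (abs_nonneg _) zero_le_one (by positivity), Real.rpow_one, mul_comm]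
  exact mul_le_mul_of_nonneg_right hroot (abs_nonneg _)

/-- The pointwise bound of the `Δ_{1+1/m}`-integrand of `h χ_{E_m}` by the `L_a`-integrand. -/
lemma indicator_abs_rpow_le {a : ℝ} (ha : 0 < a) (h : ℝ → ℝ) {m : ℕ} (hm : 1 ≤ m) (t : ℝ) :
    |(Eset h m).indicator h t| ^ (1 + 1 / (m : ℝ)) ≤
      2 * (Real.log 2 / 2) ^ (-a) * (m : ℝ) ^ (-a) * (|h t| * Real.log (2 + |h t|) ^ a) := by
  have hl2 : 0 < Real.log 2 := Real.log_pos one_lt_two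
  have hmpos : (0 : ℝ) < m := by exact_mod_cast hm
  have hlog : 0 ≤ Real.log (2 + |h t|) := Real.log_nonneg (by linarith [abs_nonneg (h t)])
  by_cases ht : t ∈ Eset h m
  · rw [Set.indicator_of_mem ht]
    have hpow : ((Real.log 2 / 2) * m) ^ a ≤ Real.log (2 + |h t|) ^ a :=
      Real.rpow_le_rpow (by positivity) (mul_log_two_le_log_of_mem_Eset hm ht) ha.le
    have hone : 1 ≤ ((Real.log 2 / 2) * m) ^ (-a) * Real.log (2 + |h t|) ^ a := by
      rw [Real.rpow_neg (by positivity), inv_mul_eq_div]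
      exact (one_le_div (by positivity)).2 hpow
    rw [Real.mul_rpow (by positivity) hmpos.le] at hone
    calc |h t| ^ (1 + 1 / (m : ℝ)) ≤ 2 * |h t| * 1 := by
          rw [mul_one]; exact abs_rpow_le_two_mul_of_mem_Eset hm ht
      _ ≤ 2 * |h t| * ((Real.log 2 / 2) ^ (-a) * (m : ℝ) ^ (-a) * Real.log (2 + |h t|) ^ a) := by
          gcongr
      _ = _ := by ring
  · rw [Set.indicator_of_notMem ht, abs_zero, Real.zero_rpow (by positivity)]
    positivity

/-- Estimate (3.3):  `‖h χ_{E_m}‖_{Δ_{1+1/m}} ≤ C m^{-am/(m+1)} L_a(h)^{m/(m+1)}`,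
with `C` depending only on `a`. -/
theorem statement17 (a : ℝ) (ha : 0 < a) :
    ∃ C > (0:ℝ), ∀ h : ℝ → ℝ, Measurable h → LaNorm a h < ⊤ →
      ∀ m : ℕ, 1 ≤ m →
        deltaNorm (1 + 1 / m) ((Eset h m).indicator h) ≤
          ENNReal.ofReal (C * (m : ℝ) ^ (-(a * m / (m + 1)))) *
            LaNorm a h ^ ((m : ℝ) / (m + 1)) := by
  have hl2 : 0 < Real.log 2 := Real.log_pos one_lt_two
  have hK : 1 ≤ 2 * (Real.log 2 / 2) ^ (-a) := by
    have : 1 ≤ (Real.log 2 / 2) ^ (-a) :=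
      Real.one_le_rpow_of_pos_of_le_one_of_nonpos (by positivity)
        (by linarith [Real.log_two_lt_d9]) (by linarith)
    linarith
  refine ⟨2 * (Real.log 2 / 2) ^ (-a), by positivity, fun h _ _ m hm => iSup_le fun j => ?_⟩
  have hmpos : (0 : ℝ) < m := by exact_mod_cast hm
  have hexp : 1 / (1 + 1 / (m : ℝ)) = (m : ℝ) / (m + 1) := by field_simp
  set K : ℝ := 2 * (Real.log 2 / 2) ^ (-a)
  have hint : ∫⁻ t in Set.Ioc ((2:ℝ) ^ j) ((2:ℝ) ^ (j + 1)),
      ENNReal.ofReal (|(Eset h m).indicator h t| ^ (1 + 1 / (m : ℝ)) / t) ≤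
      ENNReal.ofReal (K * (m : ℝ) ^ (-a)) * LaNorm a h := by
    refine le_trans ?_ (mul_le_mul_right (le_iSup _ j) _)
    rw [← lintegral_const_mul' _ _ ENNReal.ofReal_ne_top]
    refine setLIntegral_mono' measurableSet_Ioc fun t ht => ?_
    have htpos : 0 < t := lt_trans (by positivity) ht.1
    rw [← ENNReal.ofReal_mul (by positivity), ← mul_div_assoc]
    exact ENNReal.ofReal_le_ofReal
      (div_le_div_of_nonneg_right (indicator_abs_rpow_le ha h hm t) htpos.le)
  have hconst : (K * (m : ℝ) ^ (-a)) ^ ((m : ℝ) / (m + 1)) ≤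
      K * (m : ℝ) ^ (-(a * m / (m + 1))) := by
    rw [Real.mul_rpow (by positivity) (by positivity), ← Real.rpow_mul hmpos.le,
      show -a * ((m : ℝ) / (m + 1)) = -(a * m / (m + 1)) by ring]
    refine mul_le_mul_of_nonneg_right ?_ (by positivity)
    exact Real.rpow_le_self_of_one_le hK ((div_le_one (by positivity)).2 (by linarith))
  rw [hexp]
  calc _ ≤ (ENNReal.ofReal (K * (m : ℝ) ^ (-a)) * LaNorm a h) ^ ((m : ℝ) / (m + 1)) :=
        ENNReal.rpow_le_rpow hint (by positivity)
    _ = ENNReal.ofReal ((K * (m : ℝ) ^ (-a)) ^ ((m : ℝ) / (m + 1))) *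
          LaNorm a h ^ ((m : ℝ) / (m + 1)) := by
        rw [ENNReal.mul_rpow_of_nonneg _ _ (by positivity),
          ENNReal.ofReal_rpow_of_nonneg (by positivity) (by positivity)]
    _ ≤ _ := by gcongr
end

section
/- If h ∈ 𝓛_a for some a > 2, then N₁(h) < ∞, i.e. Σ_{m≥1} m 2^m d_m(h) < ∞. -/
open MeasureTheory Real Set Filter Topology
open scoped ENNReal

/-- The set `E(k,m)`:  `E(k,1) = {t ∈ (2^k, 2^{k+1}] : 0 < |h(t)| ≤ 2}` and, for `m ≥ 2`,
`E(k,m) = {t ∈ (2^k, 2^{k+1}] : 2^{m-1} < |h(t)| ≤ 2^m}`. -/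
def Ekm (h : ℝ → ℝ) (k : ℤ) (m : ℕ) : Set ℝ :=
  if m = 1 then {t | t ∈ Set.Ioc ((2:ℝ) ^ k) ((2:ℝ) ^ (k + 1)) ∧ 0 < |h t| ∧ |h t| ≤ 2}
  else {t | t ∈ Set.Ioc ((2:ℝ) ^ k) ((2:ℝ) ^ (k + 1)) ∧
    (2:ℝ) ^ (m - 1) < |h t| ∧ |h t| ≤ (2:ℝ) ^ m}

/-- `d_m(h) = sup_{k ∈ ℤ} 2^{-k} |E(k,m)|`. -/
noncomputable def dm (h : ℝ → ℝ) (m : ℕ) : ℝ≥0∞ :=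
  ⨆ k : ℤ, ENNReal.ofReal ((2:ℝ) ^ (-k)) * volume (Ekm h k m)

/-- On `E(k,m+1)`, `m ≥ 1`, the integrand defining `LaNorm a h` is at least
`2^m (m log 2)^a / 2^(k+1)`, which bounds `d_{m+1}(h)`. -/
theorem ofReal_mul_dm_succ_le_LaNorm {h : ℝ → ℝ} (hmeas : Measurable h) {a : ℝ} (ha : 0 ≤ a)
    {m : ℕ} (hm : 1 ≤ m) :
    ENNReal.ofReal ((2:ℝ) ^ m * (m * Real.log 2) ^ a / 2) * dm h (m + 1) ≤ LaNorm a h := by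
  have hlog : 0 < Real.log 2 := Real.log_pos one_lt_two
  rw [dm, ENNReal.mul_iSup]
  refine iSup_mono fun k => ?_
  have hsub : Ekm h k (m + 1) ⊆ Set.Ioc ((2:ℝ) ^ k) ((2:ℝ) ^ (k + 1)) := by
    intro t ht
    rw [Ekm, if_neg (by omega)] at ht
    exact ht.1
  refine le_trans ?_ (lintegral_mono_set hsub)
  rw [← mul_assoc, ← ENNReal.ofReal_mul (by positivity), ← setLIntegral_const]
  refine setLIntegral_mono (by fun_prop) fun t ht => ENNReal.ofReal_le_ofReal ?_
  rw [Ekm, if_neg (by omega)] at ht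
  obtain ⟨⟨ht0, ht1⟩, hlow, -⟩ := ht
  rw [Nat.add_sub_cancel] at hlow
  have htpos : 0 < t := lt_trans (by positivity) ht0
  have hlogle : m * Real.log 2 ≤ Real.log (2 + |h t|) := by
    rw [← Real.log_pow]
    exact Real.log_le_log (by positivity) (by linarith)
  have hk : (2:ℝ) ^ m * (m * Real.log 2) ^ a / 2 * 2 ^ (-k)
      = (2:ℝ) ^ m * (m * Real.log 2) ^ a / 2 ^ (k + 1) := by
    rw [zpow_add₀ two_ne_zero, zpow_neg, zpow_one]
    field_simp
  rw [hk]
  have hnonneg : 0 ≤ Real.log (2 + |h t|) := le_trans (by positivity) hlogle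
  gcongr

theorem dm_one_le_one (h : ℝ → ℝ) : dm h 1 ≤ 1 := by
  refine iSup_le fun k => ?_
  have hsub : Ekm h k 1 ⊆ Set.Ioc ((2:ℝ) ^ k) ((2:ℝ) ^ (k + 1)) := by
    intro t ht
    rw [Ekm, if_pos rfl] at ht
    exact ht.1
  calc ENNReal.ofReal ((2:ℝ) ^ (-k)) * volume (Ekm h k 1)
      ≤ ENNReal.ofReal ((2:ℝ) ^ (-k)) * volume (Set.Ioc ((2:ℝ) ^ k) ((2:ℝ) ^ (k + 1))) := by
        gcongr
    _ = 1 := by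
        rw [Real.volume_Ioc, ← ENNReal.ofReal_mul (by positivity), ← ENNReal.ofReal_one,
          zpow_add₀ two_ne_zero, zpow_neg, zpow_one]
        congr 1
        field_simp
        norm_num

theorem mul_dm_succ_le {h : ℝ → ℝ} (hmeas : Measurable h) {a : ℝ} (ha : 0 ≤ a)
    {m : ℕ} (hm : 1 ≤ m) :
    ((m : ℝ≥0∞) + 1) * 2 ^ (m + 1) * dm h (m + 1)
      ≤ ENNReal.ofReal ((m : ℝ) ^ (1 - a)) *
        (ENNReal.ofReal (8 * (Real.log 2) ^ (-a)) * LaNorm a h) := by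
  have hlog : 0 < Real.log 2 := Real.log_pos one_lt_two
  have hm1 : (1:ℝ) ≤ m := by exact_mod_cast hm
  have hm0 : (0:ℝ) < m := by linarith
  have hcoef : ((m : ℝ≥0∞) + 1) * 2 ^ (m + 1)
      = ENNReal.ofReal (((m:ℝ) + 1) * 2 ^ (m + 1)) := by
    rw [ENNReal.ofReal_mul (by positivity), ENNReal.ofReal_add hm0.le zero_le_one,
      ENNReal.ofReal_pow zero_le_two, ENNReal.ofReal_natCast, ENNReal.ofReal_one,
      ENNReal.ofReal_ofNat]
  have hreal : ((m:ℝ) + 1) * 2 ^ (m + 1) ≤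
      (m : ℝ) ^ (1 - a) * (8 * (Real.log 2) ^ (-a)) *
        ((2:ℝ) ^ m * (m * Real.log 2) ^ a / 2) := by
    have hrhs : (m : ℝ) ^ (1 - a) * (8 * (Real.log 2) ^ (-a)) *
        ((2:ℝ) ^ m * (m * Real.log 2) ^ a / 2) = 4 * m * 2 ^ m := by
      rw [Real.mul_rpow hm0.le hlog.le, Real.rpow_sub hm0, Real.rpow_one,
        Real.rpow_neg hlog.le]
      field_simp
      norm_num
    rw [hrhs, pow_succ]
    nlinarith [pow_pos (two_pos : (0:ℝ) < 2) m]
  calc ((m : ℝ≥0∞) + 1) * 2 ^ (m + 1) * dm h (m + 1)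
      ≤ ENNReal.ofReal ((m : ℝ) ^ (1 - a) * (8 * (Real.log 2) ^ (-a)) *
        ((2:ℝ) ^ m * (m * Real.log 2) ^ a / 2)) * dm h (m + 1) := by
        rw [hcoef]
        gcongr
    _ = ENNReal.ofReal ((m : ℝ) ^ (1 - a)) * (ENNReal.ofReal (8 * (Real.log 2) ^ (-a)) *
        (ENNReal.ofReal ((2:ℝ) ^ m * (m * Real.log 2) ^ a / 2) * dm h (m + 1))) := by
        rw [ENNReal.ofReal_mul (by positivity), ENNReal.ofReal_mul (by positivity)]
        simp only [mul_assoc]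
    _ ≤ _ := by
        gcongr
        exact ofReal_mul_dm_succ_le_LaNorm hmeas ha hm

/-- Remark of Section 3:  if `h ∈ 𝓛_a` for some `a > 2`, then
`N₁(h) = Σ_{m ≥ 1} m 2^m d_m(h) < ∞`. -/
theorem statement19
    (h : ℝ → ℝ) (hmeas : Measurable h) (a : ℝ) (ha : 2 < a) (hh : LaNorm a h < ⊤) :
    (∑' m : ℕ, ((m : ℝ≥0∞) + 1) * 2 ^ (m + 1) * dm h (m + 1)) < ⊤ := by
  rw [tsum_eq_zero_add' ENNReal.summable]
  refine ENNReal.add_lt_top.2 ⟨?_, ?_⟩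
  · refine ENNReal.mul_lt_top (by simp) ?_
    exact (dm_one_le_one h).trans_lt ENNReal.one_lt_top
  · refine (ENNReal.tsum_le_tsum fun m =>
      mul_dm_succ_le hmeas (by linarith : 0 ≤ a) (Nat.le_add_left 1 m)).trans_lt ?_
    rw [ENNReal.tsum_mul_right]
    refine ENNReal.mul_lt_top ?_ (ENNReal.mul_lt_top ENNReal.ofReal_lt_top hh)
    have hsum : Summable fun m : ℕ => ((m + 1 : ℕ) : ℝ) ^ (1 - a) :=
      (summable_nat_add_iff 1).2 (Real.summable_nat_rpow.2 (by linarith))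
    exact hsum.tsum_ofReal_lt_top
end
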